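/- arXiv:1506.07942 — 14 statements merged into one kernel-verified Lean document; each statement's English description precedes it below -/
import Mathlib

section
/- Let (I, (A_i), (u_i)) be a strategic form game with a finite nonempty player set I and nonempty strategy sets A_i. If φ₁ and φ₂ are both exact potentials for this game, then φ₁ − φ₂ is constant on the strategy space: there exists c ∈ ℝ such that φ₁(a) = φ₂(a) + c for every profile a ∈ ∏_{j∈I} A_j. -/
/-- A function on a finite product that is unchanged by updating any single coordinate
is constant. -/
theorem eq_of_forall_update_eq {ι : Type*} [Fintype ι] [DecidableEq ι] {A : ι → Type*}
    {β : Type*} {f : (∀ j, A j) → β}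
    (hf : ∀ (i : ι) (a : ∀ j, A j) (b : A i), f (Function.update a i b) = f a)
    (a a' : ∀ j, A j) : f a = f a' := by
  have key : ∀ s : Finset ι, f (s.piecewise a a') = f a' := by
    intro s
    induction s using Finset.induction_on with
    | empty => rw [Finset.piecewise_empty]
    | insert i s _ ih => rw [Finset.piecewise_insert, hf, ih]
  simpa using key Finset.univ

/-- Two exact potentials of the same finite-player strategic form game
differ by a constant. -/
theorem exact_potentials_differ_by_constant
    {ι : Type*} [Fintype ι] [Nonempty ι] [DecidableEq ι]
    {A : ι → Type*} [∀ i, Nonempty (A i)]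
    (u : ι → (∀ j, A j) → ℝ) (φ₁ φ₂ : (∀ j, A j) → ℝ)
    (hφ₁ : ∀ (i : ι) (a : ∀ j, A j) (b b' : A i),
      u i (Function.update a i b) - u i (Function.update a i b') =
        φ₁ (Function.update a i b) - φ₁ (Function.update a i b'))
    (hφ₂ : ∀ (i : ι) (a : ∀ j, A j) (b b' : A i),
      u i (Function.update a i b) - u i (Function.update a i b') =
        φ₂ (Function.update a i b) - φ₂ (Function.update a i b')) :
    ∃ c : ℝ, ∀ a : ∀ j, A j, φ₁ a = φ₂ a + c := by
  obtain ⟨a₀⟩ : Nonempty (∀ j, A j) := inferInstance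
  refine ⟨φ₁ a₀ - φ₂ a₀, fun a => ?_⟩
  have h : φ₁ a - φ₂ a = φ₁ a₀ - φ₂ a₀ := by
    refine eq_of_forall_update_eq (f := fun x => φ₁ x - φ₂ x) (fun i x b => ?_) a a₀
    have h₁ := hφ₁ i x b (x i)
    have h₂ := hφ₂ i x b (x i)
    rw [Function.update_eq_self] at h₁ h₂
    linarith
  linarith
end

section
/- Every ordinal potential game with finite strategy sets possesses at least one pure Nash equilibrium. Precisely: let (I, (A_i), (u_i)) be a strategic form game with finite player set I and finite nonempty strategy sets A_i, and suppose φ is an ordinal potential for the game. Then there exists a profile a* that is a pure Nash equilibrium (indeed, any profile maximizing φ over ∏_{j∈I} A_j is one). -/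
/-- Every ordinal potential game with finite strategy sets possesses a pure
Nash equilibrium; indeed, any profile maximizing the ordinal potential `φ`
is a pure Nash equilibrium. -/
theorem finite_ordinal_potential_game_has_nash_equilibrium
    {ι : Type*} [Fintype ι] [DecidableEq ι]
    {A : ι → Type*} [∀ i, Fintype (A i)] [∀ i, Nonempty (A i)]
    (u : ι → (∀ j, A j) → ℝ) (φ : (∀ j, A j) → ℝ)
    (hφ : ∀ (i : ι) (a : ∀ j, A j) (b b' : A i),
      u i (Function.update a i b) > u i (Function.update a i b') ↔
        φ (Function.update a i b) > φ (Function.update a i b')) :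
    (∃ a : ∀ j, A j, ∀ (i : ι) (b : A i), u i (Function.update a i b) ≤ u i a) ∧
      ∀ a : ∀ j, A j, (∀ b : ∀ j, A j, φ b ≤ φ a) →
        ∀ (i : ι) (b : A i), u i (Function.update a i b) ≤ u i a := by
  have nash_of_maximizer : ∀ a : ∀ j, A j, (∀ b : ∀ j, A j, φ b ≤ φ a) →
      ∀ (i : ι) (b : A i), u i (Function.update a i b) ≤ u i a := by
    intro a ha i b
    have h := hφ i a b (a i)
    rw [Function.update_eq_self] at h
    exact not_lt.mp fun hlt => (ha _).not_gt (h.mp hlt)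
  obtain ⟨a, ha⟩ := Finite.exists_max φ
  exact ⟨⟨a, nash_of_maximizer a ha⟩, nash_of_maximizer⟩
end

section
/- Every ordinal potential game with finite strategy sets has the finite improvement property: if (I, (A_i), (u_i)) is a strategic form game with finite player set I and finite nonempty strategy sets A_i that admits an ordinal potential φ, then there is no infinite improvement path, i.e., there is no sequence of profiles (a[k])_{k∈ℕ} such that for every k ∈ ℕ there exists a player i with a_j[k+1] = a_j[k] for all j ≠ i and u_i(a[k+1]) > u_i(a[k]). -/
/-- Every ordinal potential game with finite strategy sets has the finite
improvement property: there is no infinite improvement path. -/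
theorem finite_ordinal_potential_game_has_FIP
    {ι : Type*} [Fintype ι] [DecidableEq ι]
    {A : ι → Type*} [∀ i, Fintype (A i)] [∀ i, Nonempty (A i)]
    (u : ι → (∀ j, A j) → ℝ) (φ : (∀ j, A j) → ℝ)
    (hφ : ∀ (i : ι) (a : ∀ j, A j) (b b' : A i),
      u i (Function.update a i b) > u i (Function.update a i b') ↔
        φ (Function.update a i b) > φ (Function.update a i b')) :
    ¬ ∃ a : ℕ → (∀ j, A j), ∀ k : ℕ, ∃ i : ι,
        (∀ j : ι, j ≠ i → a (k + 1) j = a k j) ∧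
          u i (a (k + 1)) > u i (a k) := by
  rintro ⟨a, ha⟩
  have hmono : StrictMono (φ ∘ a) := by
    refine strictMono_nat_of_lt_succ fun k => ?_
    obtain ⟨i, hj, hu⟩ := ha k
    have hupd : Function.update (a k) i (a (k + 1) i) = a (k + 1) :=
      Function.update_eq_iff.2 ⟨rfl, fun j hne => (hj j hne).symm⟩
    have h := hφ i (a k) (a (k + 1) i) (a k i)
    rw [hupd, Function.update_eq_self] at h
    exact h.1 hu
  exact not_injective_infinite_finite a hmono.injective.of_comp
end

section
/- A strategic form game (I, (A_i), (u_i)) is an exact potential game if and only if there exist a function u : ∏_{j∈I} A_j → ℝ and, for each player i, a function d_i : ∏_{j∈I} A_j → ℝ that does not depend on player i's coordinate (i.e., d_i(a) = d_i(b) whenever a_j = b_j for all j ≠ i), such that u_i(a) = u(a) + d_i(a) for every player i and every profile a. In that case, u is an exact potential for the game. -/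
/-- A strategic form game is an exact potential game if and only if it is a
coordination-dummy game, i.e., `u i = v + d i` where each `d i` does not depend
on player `i`'s own coordinate; in that case the coordination function `v` is
an exact potential for the game. -/
theorem exact_potential_iff_coordination_dummy
    {ι : Type*} [Fintype ι] [DecidableEq ι]
    {A : ι → Type*} [∀ i, Nonempty (A i)]
    (u : ι → (∀ j, A j) → ℝ) :
    ((∃ φ : (∀ j, A j) → ℝ, ∀ (i : ι) (a : ∀ j, A j) (b b' : A i),
        u i (Function.update a i b) - u i (Function.update a i b') =
          φ (Function.update a i b) - φ (Function.update a i b')) ↔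
      (∃ (v : (∀ j, A j) → ℝ) (d : ι → (∀ j, A j) → ℝ),
        (∀ (i : ι) (a b : ∀ j, A j), (∀ j : ι, j ≠ i → a j = b j) → d i a = d i b) ∧
          ∀ (i : ι) (a : ∀ j, A j), u i a = v a + d i a)) ∧
    ∀ (v : (∀ j, A j) → ℝ) (d : ι → (∀ j, A j) → ℝ),
      (∀ (i : ι) (a b : ∀ j, A j), (∀ j : ι, j ≠ i → a j = b j) → d i a = d i b) →
      (∀ (i : ι) (a : ∀ j, A j), u i a = v a + d i a) →
      ∀ (i : ι) (a : ∀ j, A j) (b b' : A i),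
        u i (Function.update a i b) - u i (Function.update a i b') =
          v (Function.update a i b) - v (Function.update a i b') := by
  have potential_of_decomposition : ∀ (v : (∀ j, A j) → ℝ) (d : ι → (∀ j, A j) → ℝ),
      (∀ (i : ι) (a b : ∀ j, A j), (∀ j : ι, j ≠ i → a j = b j) → d i a = d i b) →
      (∀ (i : ι) (a : ∀ j, A j), u i a = v a + d i a) →
      ∀ (i : ι) (a : ∀ j, A j) (b b' : A i),
        u i (Function.update a i b) - u i (Function.update a i b') =
          v (Function.update a i b) - v (Function.update a i b') := by
    intro v d hd hu i a b b'
    have h : d i (Function.update a i b) = d i (Function.update a i b') :=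
      hd i _ _ fun j hj => by simp [hj]
    rw [hu, hu, h]
    ring
  refine ⟨⟨?_, ?_⟩, potential_of_decomposition⟩
  · rintro ⟨φ, hφ⟩
    refine ⟨φ, fun i a => u i a - φ a, fun i a b hab => ?_, fun i a => by ring⟩
    have hb : Function.update a i (b i) = b := by
      rw [Function.update_eq_iff]
      exact ⟨rfl, hab⟩
    have h := hφ i a (a i) (b i)
    rw [Function.update_eq_self, hb] at h
    linarith
  · rintro ⟨v, d, hd, hu⟩
    exact ⟨v, potential_of_decomposition v d hd hu⟩
end

section
/- Let I be a finite set of players with nonempty strategy sets A_i, and for each subset S ⊆ I let Φ_S : ∏_{j∈I} A_j → ℝ be a function that depends only on the coordinates in S (i.e., Φ_S(a) = Φ_S(b) whenever a_j = b_j for all j ∈ S). If the payoffs satisfy u_i(a) = Σ_{S ⊆ I, i ∈ S} Φ_S(a) for every player i and every profile a, then the game (I, (A_i), (u_i)) is an exact potential game with exact potential φ(a) = Σ_{S ⊆ I} Φ_S(a). -/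
open Finset in
/-- Interaction potential (Ui): if each payoff is the sum over coalitions
containing the player of coalition functions `Φ S` depending only on the
coordinates in `S`, then the game is an exact potential game with potential
`φ(a) = Σ_{S ⊆ I} Φ S (a)`. -/
theorem interaction_potential_game_is_exact_potential_game
    {ι : Type*} [Fintype ι] [DecidableEq ι]
    {A : ι → Type*} [∀ i, Nonempty (A i)]
    (Φ : Finset ι → (∀ j, A j) → ℝ)
    (hdep : ∀ (S : Finset ι) (a b : ∀ j, A j),
      (∀ j ∈ S, a j = b j) → Φ S a = Φ S b)
    (u : ι → (∀ j, A j) → ℝ)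
    (hu : ∀ (i : ι) (a : ∀ j, A j),
      u i a = ∑ S ∈ (univ : Finset (Finset ι)).filter (fun S => i ∈ S), Φ S a) :
    ∀ (i : ι) (a : ∀ j, A j) (b b' : A i),
      u i (Function.update a i b) - u i (Function.update a i b') =
        (∑ S : Finset ι, Φ S (Function.update a i b)) -
          ∑ S : Finset ι, Φ S (Function.update a i b') := by
  intro i a b b'
  rw [hu, hu, ← sum_sub_distrib, ← sum_sub_distrib]
  refine sum_subset (filter_subset _ _) fun S _ hS => ?_
  have hiS : i ∉ S := by simpa using hS
  refine sub_eq_zero.2 (hdep S _ _ fun j hj => ?_)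
  have hji : j ≠ i := ne_of_mem_of_not_mem hj hiS
  rw [Function.update_of_ne hji, Function.update_of_ne hji]
end

section
/- Every congestion game is an exact potential game with Rosenthal's potential: let I be a finite set of players, F a finite set of resources, for each player i let A_i be a nonempty collection of subsets of F, and for each f ∈ F let w_f : ℕ → ℝ. For a profile a = (a_i)_{i∈I} let n_f(a) = |{ i ∈ I : f ∈ a_i }| and define payoffs u_i(a) = Σ_{f ∈ a_i} w_f(n_f(a)). Then the game (I, (A_i), (u_i)) is an exact potential game with exact potential φ(a) = Σ_{f ∈ F} Σ_{k=1}^{n_f(a)} w_f(k). -/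
open Finset in
/-- The players using `f` after player `i` switches to `b` are the other users of `f`, together
with `i` itself when `f ∈ b`. -/
theorem card_filter_mem_update {ι F : Type*} [Fintype ι] [DecidableEq ι] [DecidableEq F]
    {𝒜 : ι → Set (Finset F)} (a : ∀ i, 𝒜 i) (i : ι) (b : 𝒜 i) (f : F) :
    (univ.filter fun j => f ∈ (Function.update a i b j : Finset F)).card =
      ((univ.erase i).filter fun j => f ∈ (a j : Finset F)).card +
        if f ∈ (b : Finset F) then 1 else 0 := by
  have hcongr : ((univ.erase i).filter fun j => f ∈ (Function.update a i b j : Finset F)) =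
      (univ.erase i).filter fun j => f ∈ (a j : Finset F) :=
    filter_congr fun j hj => by rw [Function.update_of_ne (ne_of_mem_erase hj)]
  rw [← insert_erase (mem_univ i), filter_insert, Function.update_self,
    erase_insert (notMem_erase i univ), hcongr]
  split_ifs <;> simp


open Finset in
/-- Rosenthal: every congestion game is an exact potential game with potential
`φ(a) = Σ_{f ∈ F} Σ_{k=1}^{n_f(a)} w_f(k)`, where `n_f(a)` is the number of
players using resource `f` under the profile `a`. -/
theorem congestion_game_is_exact_potential_game
    {ι : Type*} [Fintype ι] [DecidableEq ι]
    {F : Type*} [Fintype F] [DecidableEq F]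
    (𝒜 : ι → Set (Finset F)) (h𝒜 : ∀ i, (𝒜 i).Nonempty)
    (w : F → ℕ → ℝ)
    (n : F → (∀ i, 𝒜 i) → ℕ)
    (hn : ∀ (f : F) (a : ∀ i, 𝒜 i),
      n f a = (univ.filter (fun i : ι => f ∈ (a i : Finset F))).card)
    (u : ι → (∀ i, 𝒜 i) → ℝ)
    (hu : ∀ (i : ι) (a : ∀ i, 𝒜 i),
      u i a = ∑ f ∈ (a i : Finset F), w f (n f a)) :
    ∀ (i : ι) (a : ∀ i, 𝒜 i) (b b' : 𝒜 i),
      u i (Function.update a i b) - u i (Function.update a i b') =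
        (∑ f : F, ∑ k ∈ Icc 1 (n f (Function.update a i b)), w f k) -
          ∑ f : F, ∑ k ∈ Icc 1 (n f (Function.update a i b')), w f k := by
  intro i a b b'
  have potential_eq (c : 𝒜 i) :
      ∑ f : F, ∑ k ∈ Icc 1 (n f (Function.update a i c)), w f k =
        (∑ f : F, ∑ k ∈ Icc 1 ((univ.erase i).filter fun j => f ∈ (a j : Finset F)).card, w f k) +
          u i (Function.update a i c) := by
    rw [hu, Function.update_self, ← Fintype.sum_ite_mem (c : Finset F), ← sum_add_distrib]
    refine sum_congr rfl fun f _ => ?_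
    rw [hn, card_filter_mem_update]
    split_ifs
    · rw [sum_Icc_succ_top (by omega)]
    · simp
  rw [potential_eq b, potential_eq b']
  ring
end

section
/- The quasi-Cournot game with a linear inverse demand function is an exact potential game: let I be a finite set of players, each with strategy set A_i = ℝ_{>0} (positive real outputs), let α, β > 0, and for each i let cost_i : ℝ_{>0} → ℝ. Define payoffs u_i(a) = (α − β·Σ_{j∈I} a_j)·a_i − cost_i(a_i). Then the game is an exact potential game with exact potential φ(a) = α·Σ_{i∈I} a_i − β·Σ_{i∈I} a_i² − Σ_{i∈I} cost_i(a_i) − (β/2)·Σ_{i∈I} Σ_{j≠i} a_i·a_j. -/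
open Finset in
/-- Splitting off the updated coordinate from a separable sum over a profile. -/
theorem sum_apply_update {ι X M : Type*} [Fintype ι] [DecidableEq ι] [AddCommMonoid M]
    (f : ι → X → M) (a : ι → X) (i : ι) (b : X) :
    ∑ j, f j (Function.update a i b j) = f i b + ∑ j ∈ univ.erase i, f j (a j) := by
  rw [← add_sum_erase univ _ (mem_univ i), Function.update_self]
  congr 1
  refine sum_congr rfl fun j hj => ?_
  rw [Function.update_of_ne (ne_of_mem_erase hj)]

open Finset in
/-- The off-diagonal part of the square of a sum. -/
theorem sum_sum_erase_mul {ι R : Type*} [Fintype ι] [DecidableEq ι] [CommRing R] (x : ι → R) :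
    ∑ i, ∑ j ∈ univ.erase i, x i * x j = (∑ i, x i) ^ 2 - ∑ i, x i ^ 2 := by
  rw [sq, sum_mul_sum, ← sum_sub_distrib]
  refine sum_congr rfl fun i _ => ?_
  rw [sum_erase_eq_sub (mem_univ i), sq]

open Finset in
/-- The quasi-Cournot game with a linear inverse demand function is an exact
potential game with potential
`φ(a) = α·Σᵢ aᵢ − β·Σᵢ aᵢ² − Σᵢ costᵢ(aᵢ) − (β/2)·Σᵢ Σ_{j≠i} aᵢ·aⱼ`. -/
theorem quasi_cournot_is_exact_potential_game
    {ι : Type*} [Fintype ι] [DecidableEq ι]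
    (α β : ℝ) (hα : 0 < α) (hβ : 0 < β)
    (cost : ι → {x : ℝ // 0 < x} → ℝ)
    (u : ι → (ι → {x : ℝ // 0 < x}) → ℝ)
    (hu : ∀ (i : ι) (a : ι → {x : ℝ // 0 < x}),
      u i a = (α - β * ∑ j, (a j : ℝ)) * (a i : ℝ) - cost i (a i))
    (φ : (ι → {x : ℝ // 0 < x}) → ℝ)
    (hφ : ∀ a : ι → {x : ℝ // 0 < x},
      φ a = α * ∑ i, (a i : ℝ) - β * ∑ i, ((a i : ℝ)) ^ 2 - ∑ i, cost i (a i)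
        - (β / 2) * ∑ i, ∑ j ∈ univ.erase i, (a i : ℝ) * (a j : ℝ)) :
    ∀ (i : ι) (a : ι → {x : ℝ // 0 < x}) (b b' : {x : ℝ // 0 < x}),
      u i (Function.update a i b) - u i (Function.update a i b') =
        φ (Function.update a i b) - φ (Function.update a i b') := by
  intro i a b b'
  have hS := sum_apply_update (fun _ (x : {x : ℝ // 0 < x}) => (x : ℝ)) a i
  have hQ := sum_apply_update (fun _ (x : {x : ℝ // 0 < x}) => (x : ℝ) ^ 2) a i
  have hC := sum_apply_update cost a i
  simp only [hu, hφ, sum_sum_erase_mul, hS, hQ, hC, Function.update_self]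
  ring
end

section
/- The neighborhood-sum coordination game on a graph is an exact potential game: let G be a simple undirected graph on a finite player set I with nonempty strategy sets A_i, and for each i let f_i : ∏_{j∈I} A_j → ℝ be a function depending only on the coordinates of i and its graph neighbors (i.e., f_i(a) = f_i(b) whenever a_j = b_j for all j with j = i or j adjacent to i). Define payoffs u_i(a) = f_i(a) + Σ_{j : j adjacent to i} f_j(a). Then the game (I, (A_i), (u_i)) is an exact potential game with exact potential φ(a) = Σ_{i∈I} f_i(a). -/
open Finset in
/-- The neighborhood-sum coordination game on a graph: if each `f i` depends
only on the coordinates of `i` and its neighbors, and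
`uᵢ(a) = fᵢ(a) + Σ_{j ∈ N(i)} fⱼ(a)`, then the game is an exact potential game
with potential `φ(a) = Σᵢ fᵢ(a)`. -/
theorem neighborhood_sum_game_is_exact_potential_game
    {ι : Type*} [Fintype ι] [DecidableEq ι]
    (G : SimpleGraph ι) [DecidableRel G.Adj]
    {A : ι → Type*} [∀ i, Nonempty (A i)]
    (f : ι → (∀ j, A j) → ℝ)
    (hdep : ∀ (i : ι) (a b : ∀ j, A j),
      (∀ j : ι, (j = i ∨ G.Adj i j) → a j = b j) → f i a = f i b)
    (u : ι → (∀ j, A j) → ℝ)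
    (hu : ∀ (i : ι) (a : ∀ j, A j),
      u i a = f i a + ∑ j ∈ G.neighborFinset i, f j a) :
    ∀ (i : ι) (a : ∀ j, A j) (b b' : A i),
      u i (Function.update a i b) - u i (Function.update a i b') =
        (∑ j, f j (Function.update a i b)) - ∑ j, f j (Function.update a i b') := by
  intro i a b b'
  have hi : i ∉ G.neighborFinset i := by simp
  rw [hu, hu, ← sum_insert (f := fun j => f j (Function.update a i b)) hi,
    ← sum_insert (f := fun j => f j (Function.update a i b')) hi, ← sum_sub_distrib,
    ← sum_sub_distrib]
  refine sum_subset (subset_univ _) fun j _ hj => sub_eq_zero.mpr (hdep j _ _ fun k hk => ?_)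
  have hki : k ≠ i := by
    rintro rfl
    apply hj
    rw [mem_insert, SimpleGraph.mem_neighborFinset]
    exact hk.imp Eq.symm SimpleGraph.Adj.symm
  rw [Function.update_of_ne hki, Function.update_of_ne hki]
end

section
/- The channel selection game penalizing both received and generated interference is an exact potential game: let I be a finite set of transmitter–receiver pairs, each pair i having a nonempty set of channels C_i, and let G_{ij} ∈ ℝ (link gains) and P_j ∈ ℝ (transmission power levels) be constants. Define payoffs u_i(c) = −Σ_{j≠i} (G_{ij}·P_j + G_{ji}·P_i)·[c_j = c_i], where [c_j = c_i] is 1 if c_j = c_i and 0 otherwise. Then the game (I, (C_i), (u_i)) is an exact potential game with exact potential φ(c) = −Σ_{i∈I} Σ_{j≠i} G_{ij}·P_j·[c_j = c_i]. -/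
open Finset in
/-- An off-diagonal double sum splits into the terms involving a fixed index and the others. -/
theorem sum_sum_erase_eq_add {ι M : Type*} [Fintype ι] [DecidableEq ι] [AddCommMonoid M]
    (f : ι → ι → M) (i : ι) :
    ∑ k, ∑ j ∈ univ.erase k, f k j =
      ∑ j ∈ univ.erase i, (f i j + f j i) +
        ∑ k ∈ univ.erase i, ∑ j ∈ (univ.erase k).erase i, f k j := by
  rw [← add_sum_erase univ _ (mem_univ i), sum_add_distrib (f := f i), add_assoc]
  congr 1
  rw [← sum_add_distrib]
  refine sum_congr rfl fun k hk => (add_sum_erase (univ.erase k) (f k) ?_).symm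
  exact mem_erase.2 ⟨(ne_of_mem_erase hk).symm, mem_univ i⟩

open Finset in
/-- The channel selection game penalizing received and generated interference
(Nie–Comaniciu) is an exact potential game with potential
`φ(c) = −Σᵢ Σ_{j≠i} G i j · P j · [cⱼ = cᵢ]`. -/
theorem interference_channel_selection_is_exact_potential_game
    {ι : Type*} [Fintype ι] [DecidableEq ι]
    {Γ : Type*} [DecidableEq Γ]
    (𝒞 : ι → Set Γ) (h𝒞 : ∀ i, (𝒞 i).Nonempty)
    (G : ι → ι → ℝ) (P : ι → ℝ)
    (u : ι → (∀ i, 𝒞 i) → ℝ)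
    (hu : ∀ (i : ι) (c : ∀ i, 𝒞 i),
      u i c = -∑ j ∈ univ.erase i,
        (G i j * P j + G j i * P i) * (if (c j : Γ) = (c i : Γ) then 1 else 0))
    (φ : (∀ i, 𝒞 i) → ℝ)
    (hφ : ∀ c : ∀ i, 𝒞 i,
      φ c = -∑ i, ∑ j ∈ univ.erase i,
        G i j * P j * (if (c j : Γ) = (c i : Γ) then 1 else 0)) :
    ∀ (i : ι) (c : ∀ i, 𝒞 i) (b b' : 𝒞 i),
      u i (Function.update c i b) - u i (Function.update c i b') =
        φ (Function.update c i b) - φ (Function.update c i b') := by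
  intro i c b b'
  have potential_eq (d : ∀ i, 𝒞 i) : φ d = u i d -
      ∑ k ∈ univ.erase i, ∑ j ∈ (univ.erase k).erase i,
        G k j * P j * (if (d j : Γ) = (d k : Γ) then 1 else 0) := by
    rw [hφ, hu, sum_sum_erase_eq_add _ i, neg_add, sub_eq_add_neg]
    congr 2
    refine sum_congr rfl fun j _ => ?_
    rw [add_mul]
    simp only [eq_comm]
  rw [potential_eq, potential_eq, sub_sub_sub_comm, eq_comm, sub_eq_self, sub_eq_zero]
  refine sum_congr rfl fun k hk => sum_congr rfl fun j hj => ?_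
  simp only [Function.update_of_ne (ne_of_mem_erase hk), Function.update_of_ne (ne_of_mem_erase hj)]
end

section
/- In the transmitter network model with symmetric link gains, the interference-minimizing channel selection game is a weighted potential game: let I be a finite set of transmitters, each with a nonempty set of channels C_i, let G_{ij} ∈ ℝ satisfy G_{ij} = G_{ji} for all i ≠ j, and let P_i > 0 for every i. Define payoffs u_i(c) = −Σ_{j≠i} G_{ij}·P_j·[c_j = c_i], where [c_j = c_i] is 1 if c_j = c_i and 0 otherwise. Then the game (I, (C_i), (u_i)) is a weighted potential game with weights w_i = 1/P_i and weighted potential φ(c) = −(1/2)·Σ_{i∈I} P_i · Σ_{j≠i} G_{ij}·P_j·[c_j = c_i]. -/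
open Finset in
/-- An off-diagonal double sum of a symmetric function splits into twice the row sum at `i` and the
off-diagonal double sum over the indices other than `i`. -/
theorem sum_sum_erase_eq_two_mul_add_of_symm {ι R : Type*} [Fintype ι] [DecidableEq ι]
    [CommSemiring R] (S : ι → ι → R) (hS : ∀ i j, i ≠ j → S i j = S j i) (i : ι) :
    ∑ k, ∑ j ∈ univ.erase k, S k j =
      2 * ∑ j ∈ univ.erase i, S i j +
        ∑ k ∈ univ.erase i, ∑ j ∈ (univ.erase k).erase i, S k j := by
  have hrow : ∀ k ∈ univ.erase i, ∑ j ∈ univ.erase k, S k j =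
      S i k + ∑ j ∈ (univ.erase k).erase i, S k j := fun k hk ↦ by
    have hki := ne_of_mem_erase hk
    rw [← add_sum_erase (univ.erase k) (S k) (mem_erase.2 ⟨hki.symm, mem_univ i⟩), hS k i hki]
  rw [← add_sum_erase univ _ (mem_univ i), sum_congr rfl hrow, sum_add_distrib, two_mul, add_assoc]

open Finset in
/-- In the transmitter network model with symmetric link gains, the
interference-minimizing channel selection game is a weighted potential game
with weights `wᵢ = 1/Pᵢ` and weighted potential
`φ(c) = −(1/2)·Σᵢ Pᵢ·Σ_{j≠i} G i j · P j · [cⱼ = cᵢ]`. -/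
theorem symmetric_interference_channel_selection_is_weighted_potential_game
    {ι : Type*} [Fintype ι] [DecidableEq ι]
    {Γ : Type*} [DecidableEq Γ]
    (𝒞 : ι → Set Γ) (h𝒞 : ∀ i, (𝒞 i).Nonempty)
    (G : ι → ι → ℝ) (P : ι → ℝ)
    (hG : ∀ i j : ι, i ≠ j → G i j = G j i) (hP : ∀ i, 0 < P i)
    (u : ι → (∀ i, 𝒞 i) → ℝ)
    (hu : ∀ (i : ι) (c : ∀ i, 𝒞 i),
      u i c = -∑ j ∈ univ.erase i,
        G i j * P j * (if (c j : Γ) = (c i : Γ) then 1 else 0))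
    (φ : (∀ i, 𝒞 i) → ℝ)
    (hφ : ∀ c : ∀ i, 𝒞 i,
      φ c = -((1 : ℝ) / 2) * ∑ i, P i * ∑ j ∈ univ.erase i,
        G i j * P j * (if (c j : Γ) = (c i : Γ) then 1 else 0)) :
    ∀ (i : ι) (c : ∀ i, 𝒞 i) (b b' : 𝒞 i),
      u i (Function.update c i b) - u i (Function.update c i b') =
        (1 / P i) * (φ (Function.update c i b) - φ (Function.update c i b')) := by
  intro i c b b'
  have hsplit : ∀ x : 𝒞 i, φ (Function.update c i x) =
      P i * u i (Function.update c i x) - 1 / 2 * ∑ k ∈ univ.erase i,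
        ∑ j ∈ (univ.erase k).erase i,
          P k * (G k j * P j * (if (c j : Γ) = (c k : Γ) then 1 else 0)) := fun x ↦ by
    have hrest : ∀ k ∈ univ.erase i, ∀ j ∈ (univ.erase k).erase i,
        P k * (G k j * P j * (if (Function.update c i x j : Γ) = Function.update c i x k
          then 1 else 0)) =
        P k * (G k j * P j * (if (c j : Γ) = (c k : Γ) then 1 else 0)) := fun k hk j hj ↦ by
      rw [Function.update_of_ne (ne_of_mem_erase hk), Function.update_of_ne (ne_of_mem_erase hj)]
    rw [hφ, hu]
    simp only [mul_sum (univ.erase _) _ (P _)]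
    rw [sum_sum_erase_eq_two_mul_add_of_symm _ (fun k j hkj ↦ ?_) i,
      sum_congr rfl fun k hk ↦ sum_congr rfl (hrest k hk)]
    · simp only [← mul_sum]
      ring
    · simp only [hG k j hkj, eq_comm (a := (Function.update c i x j : Γ))]
      ring
  have hPi := (hP i).ne'
  rw [hsplit, hsplit]
  field_simp
  ring
end

section
/- The inverse-SINR channel selection game is an exact potential game: let I be a finite set of transmitter–receiver pairs, each pair i having a nonempty set of channels C_i, and let G_{ij} ∈ ℝ, N_i ∈ ℝ, and P_i ∈ ℝ be constants with G_{ii}·P_i ≠ 0 for every i. For a channel profile c define the interference I_i(c) = Σ_{j≠i} G_{ij}·P_j·[c_j = c_i], where [c_j = c_i] is 1 if c_j = c_i and 0 otherwise, and define payoffs u_i(c) = −(N_i + I_i(c))/(G_{ii}·P_i) − Σ_{j≠i} (G_{ji}·P_i/(G_{jj}·P_j))·[c_j = c_i]. Then the game (I, (C_i), (u_i)) is an exact potential game with exact potential φ(c) = −Σ_{i∈I} (N_i + I_i(c))/(G_{ii}·P_i). -/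
open Finset in
/-- The inverse-SINR channel selection game (Menon et al.) is an exact
potential game with potential `φ(c) = −Σᵢ (Nᵢ + Iᵢ(c))/(Gᵢᵢ·Pᵢ)`, where
`Iᵢ(c) = Σ_{j≠i} G i j · P j · [cⱼ = cᵢ]`. -/
theorem inverse_sinr_channel_selection_is_exact_potential_game
    {ι : Type*} [Fintype ι] [DecidableEq ι]
    {Γ : Type*} [DecidableEq Γ]
    (𝒞 : ι → Set Γ) (h𝒞 : ∀ i, (𝒞 i).Nonempty)
    (G : ι → ι → ℝ) (N : ι → ℝ) (P : ι → ℝ)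
    (hGP : ∀ i, G i i * P i ≠ 0)
    (I : ι → (∀ i, 𝒞 i) → ℝ)
    (hI : ∀ (i : ι) (c : ∀ i, 𝒞 i),
      I i c = ∑ j ∈ univ.erase i,
        G i j * P j * (if (c j : Γ) = (c i : Γ) then 1 else 0))
    (u : ι → (∀ i, 𝒞 i) → ℝ)
    (hu : ∀ (i : ι) (c : ∀ i, 𝒞 i),
      u i c = -((N i + I i c) / (G i i * P i)) - ∑ j ∈ univ.erase i,
        (G j i * P i / (G j j * P j)) * (if (c j : Γ) = (c i : Γ) then 1 else 0))
    (φ : (∀ i, 𝒞 i) → ℝ)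
    (hφ : ∀ c : ∀ i, 𝒞 i, φ c = -∑ i, (N i + I i c) / (G i i * P i)) :
    ∀ (i : ι) (c : ∀ i, 𝒞 i) (b b' : 𝒞 i),
      u i (Function.update c i b) - u i (Function.update c i b') =
        φ (Function.update c i b) - φ (Function.update c i b') := by
  intro i c b b'
  have key : ∀ c : ∀ i, 𝒞 i, φ c - u i c = -∑ j ∈ univ.erase i,
      (N j + ∑ k ∈ (univ.erase j).erase i,
        G j k * P k * (if (c k : Γ) = (c j : Γ) then 1 else 0)) / (G j j * P j) := by
    intro c
    have hsplit : ∀ j ∈ univ.erase i, (N j + I j c) / (G j j * P j) =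
        (N j + ∑ k ∈ (univ.erase j).erase i,
          G j k * P k * (if (c k : Γ) = (c j : Γ) then 1 else 0)) / (G j j * P j) +
        (G j i * P i / (G j j * P j)) * (if (c j : Γ) = (c i : Γ) then 1 else 0) := by
      intro j hj
      rw [hI, ← add_sum_erase (univ.erase j) _
        (mem_erase.mpr ⟨(ne_of_mem_erase hj).symm, mem_univ i⟩)]
      simp only [eq_comm (a := (c i : Γ))]
      ring
    rw [hφ, hu, ← add_sum_erase univ _ (mem_univ i), sum_congr rfl hsplit, sum_add_distrib]
    ring
  have hinv : φ (Function.update c i b) - u i (Function.update c i b) =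
      φ (Function.update c i b') - u i (Function.update c i b') := by
    rw [key, key]
    congr 1
    refine sum_congr rfl fun j hj => ?_
    congr 2
    refine sum_congr rfl fun k hk => ?_
    simp only [Function.update_of_ne (ne_of_mem_erase hj),
      Function.update_of_ne (ne_of_mem_erase hk)]
  linarith
end

section
/- The slotted-ALOHA transmission probability adjustment game is an exact potential game: let I be a finite set of nodes, each with strategy set A_i = [0, 1] (transmission probabilities), and for each i let cost_i : [0,1] → ℝ. Define payoffs u_i(x) = x_i · ∏_{j≠i} (1 − x_j) − cost_i(x_i). Then the game (I, ([0,1]), (u_i)) is an exact potential game with exact potential φ(x) = −∏_{i∈I} (1 − x_i) − Σ_{i∈I} cost_i(x_i). -/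
open Finset in
/-- The slotted-ALOHA transmission probability adjustment game is an exact
potential game with potential
`φ(x) = −∏ᵢ (1 − xᵢ) − Σᵢ costᵢ(xᵢ)`. -/
theorem slotted_aloha_is_exact_potential_game
    {ι : Type*} [Fintype ι] [DecidableEq ι]
    (cost : ι → Set.Icc (0 : ℝ) 1 → ℝ)
    (u : ι → (ι → Set.Icc (0 : ℝ) 1) → ℝ)
    (hu : ∀ (i : ι) (x : ι → Set.Icc (0 : ℝ) 1),
      u i x = (x i : ℝ) * ∏ j ∈ univ.erase i, (1 - (x j : ℝ)) - cost i (x i))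
    (φ : (ι → Set.Icc (0 : ℝ) 1) → ℝ)
    (hφ : ∀ x : ι → Set.Icc (0 : ℝ) 1,
      φ x = -∏ i, (1 - (x i : ℝ)) - ∑ i, cost i (x i)) :
    ∀ (i : ι) (x : ι → Set.Icc (0 : ℝ) 1) (b b' : Set.Icc (0 : ℝ) 1),
      u i (Function.update x i b) - u i (Function.update x i b') =
        φ (Function.update x i b) - φ (Function.update x i b') := by
  intro i x b b'
  have u_eq : ∀ c, u i (Function.update x i c) =
      (c : ℝ) * ∏ j ∈ univ.erase i, (1 - (x j : ℝ)) - cost i c := by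
    intro c
    rw [hu, Function.update_self]
    congr 2
    refine prod_congr rfl fun j hj => ?_
    rw [Function.update_of_ne (ne_of_mem_erase hj)]
  have φ_eq : ∀ c, φ (Function.update x i c) =
      -((1 - (c : ℝ)) * ∏ j ∈ univ.erase i, (1 - (x j : ℝ))) -
        (cost i c + ∑ j ∈ univ.erase i, cost j (x j)) := by
    intro c
    rw [hφ, ← mul_prod_erase univ _ (mem_univ i), ← add_sum_erase univ _ (mem_univ i),
      Function.update_self]
    congr 2
    · congr 1
      refine prod_congr rfl fun j hj => ?_
      rw [Function.update_of_ne (ne_of_mem_erase hj)]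
    · refine sum_congr rfl fun j hj => ?_
      rw [Function.update_of_ne (ne_of_mem_erase hj)]
  rw [u_eq, u_eq, φ_eq, φ_eq]
  ring
end

section
/- The Shannon-capacity uplink power control game is an exact potential game: let I be a finite set of transmitters, let N > 0 and G_i > 0 for each i, let each strategy set P_i be a nonempty subset of ℝ_{≥0}, and for each i let cost_i : ℝ_{≥0} → ℝ. Define payoffs u_i(p) = log(1 + G_i·p_i/(N + Σ_{j≠i} G_j·p_j)) − cost_i(p_i). Then the game (I, (P_i), (u_i)) is an exact potential game with exact potential φ(p) = log(N + Σ_{j∈I} G_j·p_j) − Σ_{j∈I} cost_j(p_j). -/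
open Finset in
/-- The Shannon-capacity uplink power control game (Fattahi–Paganini) is an
exact potential game with potential
`φ(p) = log(N + Σⱼ Gⱼ·pⱼ) − Σⱼ costⱼ(pⱼ)`. -/
theorem shannon_power_control_is_exact_potential_game
    {ι : Type*} [Fintype ι] [DecidableEq ι]
    (N : ℝ) (hN : 0 < N) (G : ι → ℝ) (hG : ∀ i, 0 < G i)
    (Pstrat : ι → Set NNReal) (hPstrat : ∀ i, (Pstrat i).Nonempty)
    (cost : ι → NNReal → ℝ)
    (u : ι → (∀ i, Pstrat i) → ℝ)
    (hu : ∀ (i : ι) (p : ∀ i, Pstrat i),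
      u i p = Real.log (1 + G i * ((p i : NNReal) : ℝ) /
          (N + ∑ j ∈ univ.erase i, G j * ((p j : NNReal) : ℝ))) -
        cost i (p i))
    (φ : (∀ i, Pstrat i) → ℝ)
    (hφ : ∀ p : ∀ i, Pstrat i,
      φ p = Real.log (N + ∑ j, G j * ((p j : NNReal) : ℝ)) - ∑ j, cost j (p j)) :
    ∀ (i : ι) (p : ∀ i, Pstrat i) (b b' : Pstrat i),
      u i (Function.update p i b) - u i (Function.update p i b') =
        φ (Function.update p i b) - φ (Function.update p i b') := by
  intro i p
  have key : ∀ c : Pstrat i, u i (Function.update p i c) = φ (Function.update p i c) -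
      (Real.log (N + ∑ j ∈ univ.erase i, G j * ((p j : NNReal) : ℝ)) -
        ∑ j ∈ univ.erase i, cost j (p j)) := by
    intro c
    have hpos : 0 < N + ∑ j ∈ univ.erase i, G j * ((p j : NNReal) : ℝ) :=
      add_pos_of_pos_of_nonneg hN
        (sum_nonneg fun j _ => mul_nonneg (hG j).le (NNReal.coe_nonneg _))
    have hc : 0 ≤ G i * ((c : NNReal) : ℝ) := mul_nonneg (hG i).le (NNReal.coe_nonneg _)
    have hS : ∑ j ∈ univ.erase i, G j * ((Function.update p i c j : NNReal) : ℝ) =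
        ∑ j ∈ univ.erase i, G j * ((p j : NNReal) : ℝ) :=
      sum_congr rfl fun j hj => by rw [Function.update_of_ne (ne_of_mem_erase hj)]
    have hC : ∑ j ∈ univ.erase i, cost j (Function.update p i c j) =
        ∑ j ∈ univ.erase i, cost j (p j) :=
      sum_congr rfl fun j hj => by rw [Function.update_of_ne (ne_of_mem_erase hj)]
    rw [hu, hφ, ← add_sum_erase univ _ (mem_univ i),
      ← add_sum_erase univ (fun j => cost j _) (mem_univ i), hS, hC, Function.update_self,
      one_add_div hpos.ne', Real.log_div (by positivity) hpos.ne',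
      add_comm (G i * _), ← add_assoc]
    ring
  intro b b'
  rw [key b, key b']
  ring
end

section
/- The M/M/1 arrival-rate control game with power payoffs is an ordinal potential game: let I be a finite set of users, let μ > 0 be the departure rate, let α_i > 0 for each i, and let each strategy set Λ_i be a nonempty subset of ℝ_{>0} such that Σ_{j∈I} λ_j < μ for every profile λ ∈ ∏_{j∈I} Λ_j. Define payoffs u_i(λ) = λ_i^{α_i} · (μ − Σ_{j∈I} λ_j). Then the game (I, (Λ_i), (u_i)) is an ordinal potential game with ordinal potential φ(λ) = Σ_{j∈I} α_j·log(λ_j) + log(μ − Σ_{j∈I} λ_j). -/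
/-- The M/M/1 arrival-rate control game with "power" payoffs
`uᵢ(λ) = λᵢ^{αᵢ}·(μ − Σⱼ λⱼ)` is an ordinal potential game with ordinal
potential `φ(λ) = Σⱼ αⱼ·log(λⱼ) + log(μ − Σⱼ λⱼ)`. -/
theorem mm1_arrival_rate_game_is_ordinal_potential_game
    {ι : Type*} [Fintype ι] [DecidableEq ι]
    (μ : ℝ) (hμ : 0 < μ) (α : ι → ℝ) (hα : ∀ i, 0 < α i)
    (Λ : ι → Set ℝ) (hΛne : ∀ i, (Λ i).Nonempty) (hΛpos : ∀ i, Λ i ⊆ Set.Ioi 0)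
    (hsum : ∀ l : ∀ i, Λ i, ∑ j, (l j : ℝ) < μ)
    (u : ι → (∀ i, Λ i) → ℝ)
    (hu : ∀ (i : ι) (l : ∀ i, Λ i),
      u i l = ((l i : ℝ)) ^ (α i) * (μ - ∑ j, (l j : ℝ)))
    (φ : (∀ i, Λ i) → ℝ)
    (hφ : ∀ l : ∀ i, Λ i,
      φ l = ∑ j, α j * Real.log (l j : ℝ) + Real.log (μ - ∑ j, (l j : ℝ))) :
    ∀ (i : ι) (l : ∀ i, Λ i) (b b' : Λ i),
      u i (Function.update l i b) > u i (Function.update l i b') ↔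
        φ (Function.update l i b) > φ (Function.update l i b') := by
  intro i l b b'
  have hpos (c : Λ i) : 0 < u i (Function.update l i c) := by
    rw [hu]
    exact mul_pos (Real.rpow_pos_of_pos (hΛpos i (Subtype.coe_prop _)) _)
      (sub_pos.2 (hsum _))
  have hlog (c : Λ i) : φ (Function.update l i c) =
      Real.log (u i (Function.update l i c)) +
        ∑ j ∈ Finset.univ.erase i, α j * Real.log (l j : ℝ) := by
    have hc : (0 : ℝ) < (Function.update l i c i : ℝ) := hΛpos i (Subtype.coe_prop _)
    have hrest : ∑ j ∈ Finset.univ.erase i, α j * Real.log (Function.update l i c j : ℝ) =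
        ∑ j ∈ Finset.univ.erase i, α j * Real.log (l j : ℝ) :=
      Finset.sum_congr rfl fun j hj => by
        rw [Function.update_of_ne (Finset.ne_of_mem_erase hj)]
    rw [hφ, hu, Real.log_mul (Real.rpow_pos_of_pos hc _).ne' (sub_pos.2 (hsum _)).ne',
      Real.log_rpow hc, ← Finset.add_sum_erase _ _ (Finset.mem_univ i), hrest]
    ring
  rw [hlog, hlog, gt_iff_lt, gt_iff_lt, add_lt_add_iff_right,
    Real.log_lt_log_iff (hpos b') (hpos b)]
end
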